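/- arXiv:1008.5131 — 2 statements merged into one kernel-verified Lean document; each statement's English description precedes it below -/
import Mathlib

section
/- Let n ≥ 1. Every coarse map f : H^{n+1} → H^{n+1} from the closed Euclidean half-space H^{n+1} = ℝ^n × [0,∞) (with the metric induced from the Euclidean metric on ℝ^{n+1}) to itself has the coarse fixed point property: there exist a constant R > 0, a sequence of unit vectors ζ_i ∈ S^n ∩ H^{n+1}, and a sequence of points x_i ∈ H^{n+1} with ‖x_i‖ → ∞, such that for every i both x_i and f(x_i) lie within distance R of the ray {t·ζ_i : t ≥ 0}. -/
open Metric Bornology Filter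

noncomputable section

abbrev Euc (m : ℕ) : Type := EuclideanSpace ℝ (Fin m)

/-- The closed half-space `ℝ^n × [0,∞)` inside `ℝ^{n+1}`:
points with nonnegative last coordinate. -/
def HalfSpace (n : ℕ) : Set (Euc (n+1)) := {x | 0 ≤ x (Fin.last n)}

/-- A coarse map between metric spaces: proper and bornologous. -/
def IsCoarseMap {X Y : Type*} [MetricSpace X] [MetricSpace Y] (f : X → Y) : Prop :=
  (∀ B : Set Y, IsBounded B → IsBounded (f ⁻¹' B)) ∧
  (∀ R > 0, ∃ S > 0, ∀ x x' : X, dist x x' ≤ R → dist (f x) (f x') ≤ S)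

/-- The ray `{t • ζ : t ≥ 0}` through `ζ`. -/
def Ray {m : ℕ} (ζ : Euc m) : Set (Euc m) := {y | ∃ t : ℝ, 0 ≤ t ∧ y = t • ζ}

section Brouwer

variable {E : Type*} [NormedAddCommGroup E]

theorem LipschitzWith.bijective_id_add [NormedSpace ℝ E] [CompleteSpace E] {h : E → E}
    {c : NNReal} (hh : LipschitzWith c h) (hc : c < 1) :
    Function.Bijective fun x => x + h x := by
  have H : ApproximatesLinearOn (fun x => x + h x)
      ((ContinuousLinearEquiv.refl ℝ E : E ≃L[ℝ] E) : E →L[ℝ] E) Set.univ c := by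
    rw [ApproximatesLinearOn.approximatesLinearOn_iff_lipschitzOnWith, lipschitzOnWith_univ]
    convert hh using 1
    ext x
    simp
  have hc' : Subsingleton E ∨
      c < ‖(((ContinuousLinearEquiv.refl ℝ E : E ≃L[ℝ] E).symm : E ≃L[ℝ] E) : E →L[ℝ] E)‖₊⁻¹ := by
    rcases subsingleton_or_nontrivial E with hE | hE
    · exact Or.inl hE
    · refine Or.inr ?_
      have : ‖(((ContinuousLinearEquiv.refl ℝ E : E ≃L[ℝ] E).symm : E ≃L[ℝ] E) : E →L[ℝ] E)‖₊
          = 1 := by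
        ext
        exact ContinuousLinearMap.norm_id
      rw [this]
      simpa using hc
  exact ⟨Set.injOn_univ.1 (H.injOn hc'), H.surjective hc'⟩

/-- `det (1 + z A)` is polynomial in `z`, so it is determined by its values at more than
`dim E` nodes. -/
theorem ContinuousLinearMap.det_id_add_smul_eq_sum_lagrange [NormedSpace ℝ E]
    [FiniteDimensional ℝ E] (A : E →L[ℝ] E) (s : Finset ℝ) (hs : Module.finrank ℝ E < s.card)
    (z : ℝ) :
    (ContinuousLinearMap.id ℝ E + z • A).det =
      ∑ t ∈ s, (ContinuousLinearMap.id ℝ E + t • A).det * (Lagrange.basis s id t).eval z := by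
  set b := Module.finBasis ℝ E
  set M := LinearMap.toMatrix b b (A : E →ₗ[ℝ] E)
  set p : Polynomial ℝ := ((Polynomial.X : Polynomial ℝ) • M.map ⇑Polynomial.C +
    (1 : Matrix (Fin (Module.finrank ℝ E)) (Fin (Module.finrank ℝ E)) ℝ).map ⇑Polynomial.C).det
  have hp : ∀ t : ℝ, p.eval t = (ContinuousLinearMap.id ℝ E + t • A).det := by
    intro t
    rw [ContinuousLinearMap.det, ← LinearMap.det_toMatrix b, ← Polynomial.coe_evalRingHom,
      RingHom.map_det]
    congr 1
    have : ((ContinuousLinearMap.id ℝ E + t • A : E →L[ℝ] E) : E →ₗ[ℝ] E) =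
      LinearMap.id + t • (A : E →ₗ[ℝ] E) := rfl
    rw [this, map_add (LinearMap.toMatrix b b), map_smul (LinearMap.toMatrix b b),
      LinearMap.toMatrix_id]
    ext i j
    simp only [RingHom.mapMatrix_apply, Matrix.map_apply, Matrix.add_apply, Matrix.smul_apply,
      smul_eq_mul, Polynomial.coe_evalRingHom, Polynomial.eval_add, Polynomial.eval_mul,
      Polynomial.eval_X, Polynomial.eval_C]
    rw [add_comm]
  have hdeg : p.degree < s.card := by
    refine lt_of_le_of_lt Polynomial.degree_le_natDegree ?_
    have := Polynomial.natDegree_det_X_add_C_le M 1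
    rw [Fintype.card_fin] at this
    exact_mod_cast this.trans_lt hs
  have h := congrArg (Polynomial.eval z) (Lagrange.eq_interpolate (v := id) (s := s)
    (Set.injOn_id _) hdeg)
  rw [hp, Lagrange.interpolate_apply, Polynomial.eval_finsetSum] at h
  rw [h]
  refine Finset.sum_congr rfl fun t _ => ?_
  rw [Polynomial.eval_mul, Polynomial.eval_C, id, hp]

variable [InnerProductSpace ℝ E]

/-- A Lipschitz map on the closed unit ball that vanishes on the sphere remains Lipschitz when
extended by zero. -/
theorem norm_indicator_ball_sub_le {g : E → E} {C : ℝ} (hC : 0 ≤ C)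
    (hg : ∀ x ∈ closedBall (0 : E) 1, ∀ y ∈ closedBall (0 : E) 1, ‖g x - g y‖ ≤ C * ‖x - y‖)
    (h0 : ∀ x, ‖x‖ = 1 → g x = 0) (x y : E) :
    ‖(ball (0 : E) 1).indicator g x - (ball (0 : E) 1).indicator g y‖ ≤ 2 * C * ‖x - y‖ := by
  have key : ∀ x y : E, x ∈ ball (0 : E) 1 → y ∉ ball (0 : E) 1 → ‖g x‖ ≤ 2 * C * ‖x - y‖ := by
    intro x y hx hy
    rw [mem_ball_zero_iff] at hx hy
    rw [not_lt] at hy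
    have hy0 : ‖y‖ ≠ 0 := by linarith
    have hz1 : ‖(‖y‖⁻¹ : ℝ) • y‖ = 1 := by
      rw [norm_smul, norm_inv, norm_norm, inv_mul_cancel₀ hy0]
    have h1 := hg x (by simpa using hx.le) ((‖y‖⁻¹ : ℝ) • y) (by simp [hz1])
    rw [h0 _ hz1, sub_zero] at h1
    have h2 : ‖y - (‖y‖⁻¹ : ℝ) • y‖ = ‖y‖ - 1 := by
      have : y - (‖y‖⁻¹ : ℝ) • y = (1 - ‖y‖⁻¹ : ℝ) • y := by rw [sub_smul, one_smul]
      rw [this, norm_smul, Real.norm_of_nonneg, sub_mul, inv_mul_cancel₀ hy0, one_mul]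
      exact sub_nonneg.2 (inv_le_one_of_one_le₀ hy)
    have h3 : ‖x - (‖y‖⁻¹ : ℝ) • y‖ ≤ ‖x - y‖ + ‖y - (‖y‖⁻¹ : ℝ) • y‖ :=
      norm_sub_le_norm_sub_add_norm_sub _ _ _
    have h4 : ‖y‖ - ‖x‖ ≤ ‖x - y‖ := by rw [norm_sub_rev]; exact norm_sub_norm_le _ _
    calc ‖g x‖ ≤ C * ‖x - (‖y‖⁻¹ : ℝ) • y‖ := h1
      _ ≤ C * (2 * ‖x - y‖) := by gcongr; linarith
      _ = _ := by ring
  by_cases hx : x ∈ ball (0 : E) 1 <;> by_cases hy : y ∈ ball (0 : E) 1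
  · rw [Set.indicator_of_mem hx, Set.indicator_of_mem hy]
    refine (hg x (ball_subset_closedBall hx) y (ball_subset_closedBall hy)).trans ?_
    nlinarith [mul_nonneg hC (norm_nonneg (x - y))]
  · rw [Set.indicator_of_mem hx, Set.indicator_of_notMem hy, sub_zero]
    exact key x y hx hy
  · rw [Set.indicator_of_notMem hx, Set.indicator_of_mem hy, zero_sub, norm_neg, norm_sub_rev]
    exact key y x hy hx
  · rw [Set.indicator_of_notMem hx, Set.indicator_of_notMem hy, sub_zero, norm_zero]
    positivity

/-- The derivative of a map into the unit sphere is singular. -/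
theorem HasFDerivAt.det_eq_zero_of_norm_eq_one [FiniteDimensional ℝ E] {r : E → E} {x : E}
    {r' : E →L[ℝ] E}
    (hr : HasFDerivAt r r' x) (h : ∀ᶠ y in nhds x, ‖r y‖ = 1) : r'.det = 0 := by
  by_contra hdet
  have hsq := hr.norm_sq
  have hconst : HasFDerivAt (fun y => ‖r y‖ ^ 2) (0 : E →L[ℝ] ℝ) x := by
    refine (hasFDerivAt_const (1 : ℝ) x).congr_of_eventuallyEq ?_
    filter_upwards [h] with y hy
    simp [hy]
  have heq := hsq.unique hconst
  obtain ⟨v, hv⟩ := (LinearMap.equivOfDetNeZero (r' : E →ₗ[ℝ] E) hdet).surjective (r x)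
  have hv' : r' v = r x := hv
  have := DFunLike.congr_fun heq v
  simp [hv', h.self_of_nhds] at this

variable [FiniteDimensional ℝ E]

open MeasureTheory in
/-- There is no `C¹` retraction of the closed unit ball onto the unit sphere. -/
theorem not_contDiff_retraction_sphere {r : E → E}
    (hr : ∀ x ∈ closedBall (0 : E) 1, ContDiffAt ℝ 1 r x)
    (hr1 : ∀ x ∈ closedBall (0 : E) 1, ‖r x‖ = 1) (hid : ∀ x : E, ‖x‖ = 1 → r x = x) : False := by
  let _ : MeasurableSpace E := borel E
  have : BorelSpace E := ⟨rfl⟩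
  set g : E → E := fun x => r x - x
  set A : E → E →L[ℝ] E := fun x => fderiv ℝ r x - ContinuousLinearMap.id ℝ E
  have hgA : ∀ x ∈ closedBall (0 : E) 1, HasFDerivAt g (A x) x := fun x hx =>
    ((hr x hx).differentiableAt one_ne_zero).hasFDerivAt.sub (hasFDerivAt_id x)
  have hAc : ContinuousOn A (closedBall (0 : E) 1) := fun x hx =>
    (((hr x hx).continuousAt_fderiv one_ne_zero).sub continuousAt_const).continuousWithinAt
  obtain ⟨C, hC⟩ := (isCompact_closedBall (0 : E) 1).exists_bound_of_continuousOn hAc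
  have hC0 : 0 ≤ C := (norm_nonneg _).trans (hC 0 (by simp))
  have hlip : ∀ x y, ‖(ball (0 : E) 1).indicator g x - (ball (0 : E) 1).indicator g y‖ ≤
      2 * C * ‖x - y‖ := by
    refine norm_indicator_ball_sub_le hC0 (fun x hx y hy => ?_) fun x hx => ?_
    · exact (convex_closedBall (0 : E) 1).norm_image_sub_le_of_norm_hasFDerivWithin_le
        (fun z hz => (hgA z hz).hasFDerivWithinAt) hC hy hx
    · simp [g, hid x hx]
  -- For small `t` the map `x ↦ x + t g(x)` is an orientation preserving bijection of the ball
  obtain ⟨δ, hδ, hdet⟩ : ∃ δ > 0, ∀ L : E →L[ℝ] E, ‖L‖ < δ →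
      0 < (ContinuousLinearMap.id ℝ E + L).det := by
    have h1 : ContinuousAt (fun L : E →L[ℝ] E => (ContinuousLinearMap.id ℝ E + L).det) 0 :=
      (ContinuousLinearMap.continuous_det.comp (continuous_const.add continuous_id)).continuousAt
    have h2 : 0 < (ContinuousLinearMap.id ℝ E + 0 : E →L[ℝ] E).det := by
      rw [add_zero, ContinuousLinearMap.det, ContinuousLinearMap.coe_id, LinearMap.det_id]
      exact one_pos
    obtain ⟨δ, hδ, H⟩ := Metric.eventually_nhds_iff.1 (h1.eventually (lt_mem_nhds h2))
    exact ⟨δ, hδ, fun L hL => H (by simpa using hL)⟩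
  set V : ℝ → ℝ := fun t => ∫ x in ball (0 : E) 1, (ContinuousLinearMap.id ℝ E + t • A x).det
  have hV : ∀ t : ℝ, 0 ≤ t → t * C < δ → t * (2 * C) < 1 → V t = volume.real (ball (0 : E) 1) := by
    intro t ht htδ ht1
    set h : E → E := fun x => t • (ball (0 : E) 1).indicator g x
    have hh : LipschitzWith (t * (2 * C)).toNNReal h := by
      refine LipschitzWith.of_dist_le_mul fun x y => ?_
      rw [dist_eq_norm, dist_eq_norm, ← smul_sub, norm_smul, Real.norm_of_nonneg ht, 
        Real.coe_toNNReal _ (by positivity), mul_assoc]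
      gcongr
      exact hlip x y
    have hbij := hh.bijective_id_add (by simpa using ht1)
    set F : E → E := fun x => x + h x
    have himage : F '' ball (0 : E) 1 = ball (0 : E) 1 := by
      have hcompl : F '' (ball (0 : E) 1)ᶜ = (ball (0 : E) 1)ᶜ := by
        refine (Set.EqOn.image_eq (f₂ := id) fun x hx => ?_).trans (Set.image_id _)
        simp [F, h, Set.indicator_of_notMem hx]
      rw [Set.image_compl_eq hbij] at hcompl
      exact compl_injective hcompl
    have hF : ∀ x ∈ ball (0 : E) 1, HasFDerivWithinAt F
        (ContinuousLinearMap.id ℝ E + t • A x) (ball (0 : E) 1) x := by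
      intro x hx
      have := (hasFDerivAt_id x).add ((hgA x (ball_subset_closedBall hx)).const_smul t)
      refine this.hasFDerivWithinAt.congr' (fun y hy => ?_) hx
      simp [F, h, Set.indicator_of_mem hy]
    have key := integral_image_eq_integral_abs_det_fderiv_smul (volume : Measure E)
      measurableSet_ball hF hbij.injective.injOn (fun _ => (1 : ℝ))
    rw [himage, setIntegral_const, smul_eq_mul, mul_one] at key
    rw [key]
    refine setIntegral_congr_fun measurableSet_ball fun x hx => ?_
    simp only [smul_eq_mul, mul_one]
    rw [abs_of_pos]
    refine hdet _ ?_
    rw [norm_smul, Real.norm_of_nonneg ht]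
    exact (mul_le_mul_of_nonneg_left (hC x (ball_subset_closedBall hx)) ht).trans_lt htδ
  obtain ⟨ε, hε, hε1, hε2⟩ : ∃ ε > 0, ε * C < δ ∧ ε * (2 * C) < 1 := by
    have h1 : Tendsto (fun t : ℝ => t * C) (nhdsWithin 0 (Set.Ioi 0)) (nhds 0) := by
      refine tendsto_nhdsWithin_of_tendsto_nhds ?_
      simpa using (continuous_mul_const C).tendsto 0
    have h2 : Tendsto (fun t : ℝ => t * (2 * C)) (nhdsWithin 0 (Set.Ioi 0)) (nhds 0) := by
      refine tendsto_nhdsWithin_of_tendsto_nhds ?_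
      simpa using (continuous_mul_const (2 * C)).tendsto 0
    exact ((eventually_mem_nhdsWithin (a := (0 : ℝ)) (s := Set.Ioi 0)).and
      ((h1.eventually (gt_mem_nhds hδ)).and (h2.eventually (gt_mem_nhds one_pos)))).exists
  obtain ⟨s, hsub, hcard⟩ := (Set.Icc_infinite hε).exists_subset_card_eq (Module.finrank ℝ E + 1)
  have hdetc : ∀ t : ℝ, ContinuousOn (fun x => (ContinuousLinearMap.id ℝ E + t • A x).det)
      (closedBall (0 : E) 1) := fun t =>
    ContinuousLinearMap.continuous_det.comp_continuousOn
      (continuousOn_const.add (hAc.const_smul t))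
  have hint : ∀ t : ℝ, IntegrableOn (fun x => (ContinuousLinearMap.id ℝ E + t • A x).det)
      (ball (0 : E) 1) := fun t =>
    ((hdetc t).integrableOn_compact (isCompact_closedBall _ _)).mono_set ball_subset_closedBall
  have hpoly : ∀ z, V z = ∑ t ∈ s, V t * (Lagrange.basis s id t).eval z := by
    intro z
    simp only [V]
    rw [integral_congr_ae (ae_of_all _ fun x =>
      (A x).det_id_add_smul_eq_sum_lagrange s (by omega) z),
      integral_finsetSum _ fun t _ => (hint t).mul_const _]
    exact Finset.sum_congr rfl fun t _ => integral_mul_const _ _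
  have hV0 : V 0 = volume.real (ball (0 : E) 1) :=
    hV 0 le_rfl (by simpa using hδ) (by simp)
  have hV1 : V 1 = volume.real (ball (0 : E) 1) := by
    have hs : ∀ t ∈ s, V t = volume.real (ball (0 : E) 1) := by
      intro t ht
      obtain ⟨h0, hle⟩ := hsub ht
      exact hV t h0 (lt_of_le_of_lt (by gcongr) hε1) (lt_of_le_of_lt (by gcongr) hε2)
    rw [hpoly, Finset.sum_congr rfl fun t ht => by rw [hs t ht], ← Finset.mul_sum,
      ← Polynomial.eval_finsetSum, Lagrange.sum_basis (Set.injOn_id _)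
        (Finset.card_pos.1 (by omega)), Polynomial.eval_one, mul_one]
  have hzero : V 1 = 0 := by
    refine (setIntegral_congr_fun measurableSet_ball fun x hx => ?_).trans (integral_zero E ℝ)
    have hx' := ball_subset_closedBall hx
    have : ContinuousLinearMap.id ℝ E + (1 : ℝ) • A x = fderiv ℝ r x := by simp [A]
    simp only [this]
    refine HasFDerivAt.det_eq_zero_of_norm_eq_one
      ((hr x hx').differentiableAt one_ne_zero).hasFDerivAt ?_
    filter_upwards [isOpen_ball.mem_nhds hx] with y hy
    exact hr1 y (ball_subset_closedBall hy)
  have hpos : 0 < volume.real (ball (0 : E) 1) :=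
    ENNReal.toReal_pos (measure_ball_pos _ _ one_pos).ne' measure_ball_lt_top.ne
  linarith

theorem exists_fixedPoint_closedBall_of_contDiff {F : E → E} (hF : ContDiff ℝ 1 F)
    (hmaps : ∀ x ∈ closedBall (0 : E) 1, F x ∈ closedBall (0 : E) 1) :
    ∃ x ∈ closedBall (0 : E) 1, F x = x := by
  by_contra! hne
  set u : E → E := fun x => x - F x
  have hu : ∀ x ∈ closedBall (0 : E) 1, 0 < ‖u x‖ ^ 2 := fun x hx => by
    have : u x ≠ 0 := sub_ne_zero.2 (hne x hx).symm
    positivity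
  set D : E → ℝ := fun x => inner ℝ x (u x) ^ 2 + ‖u x‖ ^ 2 * (1 - ‖x‖ ^ 2)
  have hsphere : ∀ x : E, ‖x‖ = 1 → 0 < inner ℝ x (u x) := by
    intro x hx
    have hxb : x ∈ closedBall (0 : E) 1 := by simp [hx]
    have hFx : ‖F x‖ ≤ 1 := by simpa using hmaps x hxb
    have h1 := hu x hxb
    have h2 : ‖F x‖ ^ 2 = ‖x‖ ^ 2 - 2 * inner ℝ x (u x) + ‖u x‖ ^ 2 := by
      rw [← norm_sub_sq_real]; simp [u]
    rw [hx] at h2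
    nlinarith [norm_nonneg (F x)]
  have hD : ∀ x ∈ closedBall (0 : E) 1, 0 < D x := by
    intro x hx
    have hx1 : ‖x‖ ≤ 1 := by simpa using hx
    rcases hx1.lt_or_eq with h | h
    · have : 0 < 1 - ‖x‖ ^ 2 := by nlinarith [norm_nonneg x]
      have := mul_pos (hu x hx) this
      positivity
    · have := hsphere x h
      simp only [D, h]
      norm_num
      positivity
  set c : E → ℝ := fun x => (√(D x) - inner ℝ x (u x)) / ‖u x‖ ^ 2
  have huC : ContDiff ℝ 1 u := contDiff_id.sub hF
  have hin : ContDiff ℝ 1 fun x => inner ℝ x (u x) := contDiff_id.inner ℝ huC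
  have hDC : ContDiff ℝ 1 D :=
    (hin.pow 2).add ((huC.norm_sq ℝ).mul (contDiff_const.sub (contDiff_id.norm_sq ℝ)))
  refine not_contDiff_retraction_sphere (r := fun x => x + c x • u x) (fun x hx => ?_)
    (fun x hx => ?_) fun x hx => ?_
  · exact contDiffAt_id.add ((((hDC.contDiffAt.sqrt (hD x hx).ne').sub hin.contDiffAt).div
      (huC.norm_sq ℝ).contDiffAt (hu x hx).ne').smul huC.contDiffAt)
  · have h1 : ‖x + c x • u x‖ ^ 2 = 1 := by
      rw [norm_add_sq_real, inner_smul_right, norm_smul, mul_pow, Real.norm_eq_abs, sq_abs]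
      have h2 := Real.sq_sqrt (hD x hx).le
      have h3 := (hu x hx).ne'
      have hcu : c x * ‖u x‖ ^ 2 = √(D x) - inner ℝ x (u x) := div_mul_cancel₀ _ h3
      refine mul_left_cancel₀ h3 ?_
      simp only [D] at h2 hcu
      linear_combination (c x * ‖u x‖ ^ 2 + √(D x) + inner ℝ x (u x)) * hcu + h2
    exact (pow_eq_one_iff_of_nonneg (norm_nonneg _) two_ne_zero).1 h1
  · have : c x = 0 := by
      simp only [c, D, hx]
      norm_num
      left
      rw [Real.sqrt_sq (hsphere x hx).le, sub_self]
    simp [this]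

/-- **Brouwer's fixed point theorem** for the closed unit ball. -/
theorem exists_fixedPoint_closedBall {f : E → E} (hf : ContinuousOn f (closedBall (0 : E) 1))
    (hmaps : Set.MapsTo f (closedBall (0 : E) 1) (closedBall (0 : E) 1)) :
    ∃ x ∈ closedBall (0 : E) 1, f x = x := by
  by_contra! hne
  obtain ⟨x₀, hx₀, hmin⟩ := (isCompact_closedBall (0 : E) 1).exists_isMinOn
    ⟨0, by simp⟩ (continuousOn_id.sub hf).norm
  set ε := ‖x₀ - f x₀‖
  have hε : 0 < ε := norm_pos_iff.2 (sub_ne_zero.2 (hne x₀ hx₀).symm)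
  set p : E → E := fun x => (max 1 ‖x‖)⁻¹ • x
  have hpb : ∀ x, p x ∈ closedBall (0 : E) 1 := by
    intro x
    have : 0 < max 1 ‖x‖ := by positivity
    rw [mem_closedBall_zero_iff, norm_smul, norm_inv, Real.norm_of_nonneg this.le,
      inv_mul_le_one₀ this]
    exact le_max_right _ _
  have hp1 : ∀ x ∈ closedBall (0 : E) 1, p x = x := by
    intro x hx
    rw [mem_closedBall_zero_iff] at hx
    simp [p, max_eq_left hx]
  have hpc : Continuous p := by
    refine Continuous.smul (Continuous.inv₀ (by fun_prop) fun x => ?_) continuous_id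
    have : 0 < max 1 ‖x‖ := by positivity
    exact this.ne'
  have hfp : Continuous (f ∘ p) := hf.comp_continuous hpc hpb
  obtain ⟨g, hg⟩ := exists_contMDiffMap_forall_mem_convex_of_local_const (n := 1)
    (modelWithCornersSelf ℝ E) (t := fun x => closedBall (0 : E) 1 ∩ ball (f (p x)) ε)
    (fun x => (convex_closedBall _ _).inter (convex_ball _ _)) fun x => by
      refine ⟨f (p x), ?_⟩
      filter_upwards [hfp.continuousAt.eventually (ball_mem_nhds _ hε)] with y hy
      exact ⟨hmaps (hpb x), by rw [mem_ball_comm]; exact hy⟩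
  obtain ⟨x, hx, hgx⟩ := exists_fixedPoint_closedBall_of_contDiff
    (contMDiff_iff_contDiff.1 g.contMDiff) fun x _ => (hg x).1
  have h1 : dist (g x) (f (p x)) < ε := (hg x).2
  rw [hp1 x hx, hgx, dist_eq_norm] at h1
  exact absurd (hmin hx) (not_le.2 h1)

end Brouwer

theorem smul_mem_halfSpace {n : ℕ} {t : ℝ} (ht : 0 ≤ t) {x : Euc (n+1)} (hx : x ∈ HalfSpace n) :
    t • x ∈ HalfSpace n :=
  mul_nonneg ht hx

theorem convex_halfSpace (n : ℕ) : Convex ℝ (HalfSpace n) := by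
  intro x hx y hy a b ha hb _
  exact add_nonneg (mul_nonneg ha hx) (mul_nonneg hb hy)

/-- The closed upper hemisphere of the unit sphere. -/
def hemisphere (n : ℕ) : Set (Euc (n+1)) := {x | ‖x‖ = 1 ∧ x ∈ HalfSpace n}

/-- The closed upper hemisphere is a ball, so it has the fixed point property. -/
theorem exists_fixedPoint_hemisphere {n : ℕ} (φ : hemisphere n → hemisphere n)
    (hφ : Continuous φ) : ∃ p, φ p = p := by
  set q : Euc (n+1) → Euc n := fun x => WithLp.toLp 2 fun i => x i.castSucc
  set e : Euc n → Euc (n+1) := fun y => WithLp.toLp 2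
    (Fin.snoc (α := fun _ => ℝ) (fun i => y i) √(1 - ‖y‖ ^ 2))
  have hqn : ∀ x, ‖x‖ ^ 2 = ‖q x‖ ^ 2 + x (Fin.last n) ^ 2 := by
    intro x
    simp [EuclideanSpace.norm_sq_eq, Fin.sum_univ_castSucc, q]
  have hq : Continuous q := by fun_prop
  have he : Continuous e := by
    refine (PiLp.continuous_toLp 2 _).comp (continuous_pi fun i => ?_)
    refine Fin.lastCases ?_ (fun j => ?_) i
    · simp only [Fin.snoc_last]; fun_prop
    · simp only [Fin.snoc_castSucc]; fun_prop
  have hqe : ∀ y, q (e y) = y := fun y => by ext i; simp [q, e]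
  have hel : ∀ y, e y (Fin.last n) = √(1 - ‖y‖ ^ 2) := fun y => by simp [e]
  have hem : ∀ y ∈ closedBall (0 : Euc n) 1, e y ∈ hemisphere n := by
    intro y hy
    rw [mem_closedBall_zero_iff] at hy
    refine ⟨(pow_eq_one_iff_of_nonneg (norm_nonneg _) two_ne_zero).1 ?_, ?_⟩
    · rw [hqn, hqe, hel, Real.sq_sqrt (by nlinarith [norm_nonneg y])]
      ring
    · exact (Real.sqrt_nonneg _).trans_eq (hel y).symm
  have hqb : ∀ x ∈ hemisphere n, q x ∈ closedBall (0 : Euc n) 1 := by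
    rintro x ⟨hx, -⟩
    have := hqn x
    rw [hx] at this
    rw [mem_closedBall_zero_iff]
    nlinarith [norm_nonneg (q x), sq_nonneg (x (Fin.last n))]
  have heq : ∀ x ∈ hemisphere n, e (q x) = x := by
    rintro x ⟨hx, hx0⟩
    ext i
    refine Fin.lastCases ?_ (fun j => ?_) i
    · have := hqn x
      rw [hx] at this
      rw [hel, show 1 - ‖q x‖ ^ 2 = x (Fin.last n) ^ 2 by linarith, Real.sqrt_sq hx0]
    · simp [e, q]
  set ψ : closedBall (0 : Euc n) 1 → Euc n := fun y => q (φ ⟨e y, hem y y.2⟩)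
  have hψ : Continuous ψ := hq.comp
    (continuous_subtype_val.comp (hφ.comp ((he.comp continuous_subtype_val).subtype_mk _)))
  obtain ⟨y, hy, hfix⟩ := exists_fixedPoint_closedBall
    (f := Function.extend Subtype.val ψ 0)
    (continuousOn_iff_continuous_domRestrict.2
      (hψ.congr fun y => (Subtype.val_injective.extend_apply ψ 0 y).symm)) (fun y hy => by
      rw [show Function.extend Subtype.val ψ 0 y = ψ ⟨y, hy⟩ from
        Subtype.val_injective.extend_apply ψ 0 ⟨y, hy⟩]
      exact hqb _ (φ _).2)
  rw [show Function.extend Subtype.val ψ 0 y = ψ ⟨y, hy⟩ from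
    Subtype.val_injective.extend_apply ψ 0 ⟨y, hy⟩] at hfix
  refine ⟨⟨e y, hem y hy⟩, Subtype.ext ?_⟩
  rw [← heq _ (φ _).2]
  exact congrArg e hfix

/-- Every coarse map from the half-space `H^{n+1} = ℝ^n × [0,∞)` to itself has the
coarse fixed point property. -/
theorem coarse_fixed_point_halfSpace (n : ℕ) (hn : 1 ≤ n)
    (f : HalfSpace n → HalfSpace n) (hf : IsCoarseMap f) :
    ∃ R > (0:ℝ), ∃ ζ : ℕ → Euc (n+1), ∃ x : ℕ → HalfSpace n,
      (∀ i, ‖ζ i‖ = 1 ∧ (ζ i) ∈ HalfSpace n) ∧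
      Tendsto (fun i => ‖(x i : Euc (n+1))‖) atTop atTop ∧
      (∀ i, infDist (x i : Euc (n+1)) (Ray (ζ i)) ≤ R ∧
            infDist (f (x i) : Euc (n+1)) (Ray (ζ i)) ≤ R) := by
  obtain ⟨hprop, hborn⟩ := hf
  obtain ⟨S, hS, hfS⟩ := hborn 1 one_pos
  obtain ⟨g, hg⟩ := exists_continuous_forall_mem_convex_of_local_const
    (t := fun x : HalfSpace n => HalfSpace n ∩ closedBall (f x : Euc (n+1)) S)
    (fun x => (convex_halfSpace n).inter (convex_closedBall _ _)) fun x => by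
      refine ⟨f x, ?_⟩
      filter_upwards [closedBall_mem_nhds x one_pos] with y hy
      exact ⟨(f x).2, hfS x y (by rw [dist_comm]; exact hy)⟩
  obtain ⟨o, ho⟩ : ∃ o : HalfSpace n, (o : Euc (n+1)) = 0 := ⟨⟨0, by simp [HalfSpace]⟩, rfl⟩
  obtain ⟨ρ, hρ⟩ := (hprop (closedBall o S) isBounded_closedBall).subset_closedBall o
  have hg0 : ∀ x : HalfSpace n, ρ < ‖(x : Euc (n+1))‖ → g x ≠ 0 := by
    intro x hx h0
    have h1 : dist (g x) (f x : Euc (n+1)) ≤ S := (hg x).2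
    rw [h0, ← ho, dist_comm, ← Subtype.dist_eq] at h1
    have h2 : dist x o ≤ ρ := mem_closedBall.1 (hρ (Set.mem_preimage.2 (mem_closedBall.2 h1)))
    rw [Subtype.dist_eq, ho, dist_zero_right] at h2
    linarith
  have key : ∀ t : ℝ, 0 < t → ρ < t → ∃ p : Euc (n+1), ‖p‖ = 1 ∧ p ∈ HalfSpace n ∧
      ∃ x : HalfSpace n, (x : Euc (n+1)) = t • p ∧ g x = ‖g x‖ • p := by
    intro t ht hρt
    have hmem : ∀ p : hemisphere n, t • (p : Euc (n+1)) ∈ HalfSpace n :=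
      fun p => smul_mem_halfSpace ht.le p.2.2
    have hne : ∀ p : hemisphere n, g ⟨t • (p : Euc (n+1)), hmem p⟩ ≠ 0 := fun p =>
      hg0 _ (by rwa [norm_smul, p.2.1, mul_one, Real.norm_of_nonneg ht.le])
    have hm : Continuous fun p : hemisphere n =>
        (⟨t • (p : Euc (n+1)), hmem p⟩ : HalfSpace n) :=
      (continuous_subtype_val.const_smul t).subtype_mk _
    have hc : Continuous fun p : hemisphere n => g ⟨t • (p : Euc (n+1)), hmem p⟩ :=
      g.continuous.comp hm
    obtain ⟨p, hp⟩ := exists_fixedPoint_hemisphere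
      (fun p => ⟨‖g ⟨t • (p : Euc (n+1)), hmem p⟩‖⁻¹ • g ⟨t • (p : Euc (n+1)), hmem p⟩,
        by
          rw [norm_smul, norm_inv, norm_norm, inv_mul_cancel₀ (norm_ne_zero_iff.2 (hne p))],
        smul_mem_halfSpace (by positivity) (hg _).1⟩)
      (((hc.norm.inv₀ fun p => norm_ne_zero_iff.2 (hne p)).smul hc).subtype_mk _)
    refine ⟨p, p.2.1, p.2.2, ⟨_, hmem p⟩, rfl, ?_⟩
    exact (inv_smul_eq_iff₀ (norm_ne_zero_iff.2 (hne p))).1 (congrArg Subtype.val hp)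
  have hpos : ∀ i : ℕ, 0 < max ρ 0 + (i + 1 : ℝ) := fun i => by positivity
  choose ζ hζ hζH x hx hgx using fun i : ℕ => key (max ρ 0 + (i + 1 : ℝ)) (hpos i)
    (by linarith [le_max_left ρ 0, (Nat.cast_nonneg i : (0 : ℝ) ≤ i)])
  have hray : ∀ i, ∀ t : ℝ, 0 ≤ t → t • ζ i ∈ Ray (ζ i) := fun i t ht => ⟨t, ht, rfl⟩
  refine ⟨S, hS, ζ, x, fun i => ⟨hζ i, hζH i⟩, ?_, fun i => ⟨?_, ?_⟩⟩
  · have : (fun i => ‖(x i : Euc (n+1))‖) = fun i : ℕ => max ρ 0 + (i + 1 : ℝ) := by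
      ext i
      rw [hx, norm_smul, hζ, mul_one, Real.norm_of_nonneg (hpos i).le]
    rw [this]
    exact tendsto_atTop_add_const_left _ _
      (tendsto_atTop_add_const_right _ _ tendsto_natCast_atTop_atTop)
  · rw [hx, infDist_zero_of_mem (hray i _ (hpos i).le)]
    exact hS.le
  · refine (infDist_le_dist_of_mem (hray i _ (norm_nonneg (g (x i))))).trans ?_
    rw [← hgx, dist_comm]
    exact (hg (x i)).2
end
end

section
/- Let n ≥ 1. Every coarse map f : H^{n+1} → H^{n+1} from the closed Euclidean half-space H^{n+1} = ℝ^n × [0,∞) to itself has the weak coarse fixed point property: there exists a unit vector ζ ∈ S^n ∩ H^{n+1} such that for every open neighborhood U of ζ in the unit sphere S^n there is a sequence of points x_i ∈ H^{n+1} with ‖x_i‖ → ∞ such that, for every i, both x_i and f(x_i) lie in the open cone OU = {t·u : t ≥ 0, u ∈ U}. -/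
open Metric Bornology Filter

noncomputable section

/-- The open cone `OU = {t • u : t ≥ 0, u ∈ U}` on a subset `U` of the unit sphere. -/
def OpenCone {m : ℕ} (U : Set (Euc m)) : Set (Euc m) :=
  {y | ∃ t : ℝ, 0 ≤ t ∧ ∃ u ∈ U, y = t • u}

namespace WCFP

/-- The determinant of `1 + A` is an affine combination, with weights independent of `A`,
of the determinants of `1 + tᵢ A` at sufficiently many distinct nodes `tᵢ`. -/
theorem exists_weights_det_one_add {E ι : Type*} [AddCommGroup E] [Module ℝ E]
    [FiniteDimensional ℝ E] [DecidableEq ι] (s : Finset ι) (t : ι → ℝ) (ht : Set.InjOn t s)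
    (hs : Module.finrank ℝ E < s.card) :
    ∃ w : ι → ℝ, ∑ i ∈ s, w i = 1 ∧ ∀ A : E →ₗ[ℝ] E,
      LinearMap.det (1 + A) = ∑ i ∈ s, w i * LinearMap.det (1 + t i • A) := by
  refine ⟨fun i => (Lagrange.basis s t i).eval 1, ?_, fun A => ?_⟩
  · rw [← Polynomial.eval_finsetSum, Lagrange.sum_basis ht (Finset.card_pos.1 (by omega)),
      Polynomial.eval_one]
  · let b := Module.finBasis ℝ E
    let M := LinearMap.toMatrix b b A
    let P : Polynomial ℝ := Matrix.det
      ((Polynomial.X : Polynomial ℝ) • M.map Polynomial.C + (1 : Matrix _ _ ℝ).map Polynomial.C)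
    have hP : ∀ u : ℝ, P.eval u = LinearMap.det (1 + u • A) := fun u => by
      rw [← LinearMap.det_toMatrix b, map_add, map_smul, LinearMap.toMatrix_one, add_comm]
      rw [← Polynomial.coe_evalRingHom, RingHom.map_det]
      congr 1
      ext i j
      by_cases hij : i = j <;> simp [M, hij, mul_comm u]
    have hdeg : P.degree < s.card := by
      refine (Polynomial.degree_le_natDegree).trans_lt ?_
      have h := Polynomial.natDegree_det_X_add_C_le M 1
      rw [Fintype.card_fin] at h
      exact_mod_cast h.trans_lt hs
    have h1 := congrArg (Polynomial.eval 1) (Lagrange.eq_interpolate ht hdeg)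
    rw [hP, Lagrange.interpolate_apply, Polynomial.eval_finsetSum] at h1
    simp only [one_smul] at h1
    rw [h1]
    refine Finset.sum_congr rfl fun i _ => ?_
    rw [Polynomial.eval_mul, Polynomial.eval_C, hP, mul_comm]

theorem det_one_add_pos {E : Type*} [NormedAddCommGroup E] [NormedSpace ℝ E]
    [FiniteDimensional ℝ E] (A : E →L[ℝ] E) (hA : ‖A‖ < 1) : 0 < (1 + A).det := by
  have hne : ∀ s ∈ Set.Icc (0 : ℝ) 1, (1 + s • A).det ≠ 0 := by
    intro s hs h0
    obtain ⟨v, hv, hv0⟩ := (Submodule.ne_bot_iff _).1 (LinearMap.bot_lt_ker_of_det_eq_zero h0).ne'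
    have h1 : v + s • A v = 0 := hv
    have h2 : ‖v‖ = s * ‖A v‖ := by
      conv_lhs => rw [eq_neg_of_add_eq_zero_left h1]
      rw [norm_neg, norm_smul, Real.norm_of_nonneg hs.1]
    have h3 : ‖A v‖ ≤ ‖A‖ * ‖v‖ := A.le_opNorm v
    have h4 : 0 < ‖v‖ := norm_pos_iff.2 hv0
    nlinarith [hs.1, hs.2, norm_nonneg (A v)]
  have hc : Continuous fun s : ℝ => (1 + s • A).det :=
    ContinuousLinearMap.continuous_det.comp (by fun_prop)
  by_contra! hle
  obtain ⟨s, hs, h⟩ := intermediate_value_Icc' (zero_le_one (α := ℝ)) hc.continuousOn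
    (show (0 : ℝ) ∈ Set.Icc _ _ by
      refine ⟨by simpa using hle, ?_⟩
      have h1 : (1 : E →L[ℝ] E).det = 1 := LinearMap.det_id
      simp [h1])
  exact hne s hs h

section Analytic

variable {E : Type*} [NormedAddCommGroup E] [InnerProductSpace ℝ E] [FiniteDimensional ℝ E]

theorem det_fderiv_eq_zero_of_norm_const {r : E → E} {R : ℝ} (hR : 0 < R)
    (hr : Differentiable ℝ r) (hn : ∀ x, ‖r x‖ = R) (x : E) : (fderiv ℝ r x).det = 0 := by
  by_contra h
  obtain ⟨v, hv⟩ : ∃ v, fderiv ℝ r x v = r x :=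
    (LinearMap.equivOfDetNeZero (fderiv ℝ r x : E →ₗ[ℝ] E) h).surjective (r x)
  have hd := ((hr x).hasFDerivAt.inner ℝ (hr x).hasFDerivAt)
  have hconst : (fun y => inner ℝ (r y) (r y)) = fun _ => R ^ 2 := by
    funext y
    rw [real_inner_self_eq_norm_sq, hn]
  rw [hconst] at hd
  have h0 := congrArg (fun L => L v) (hd.unique (hasFDerivAt_const _ _))
  simp [hv, hn] at h0
  exact hR.ne' h0

open MeasureTheory

theorem image_ball_add_eq_ball {h : E → E} {R : ℝ} {c : NNReal} (hR : 0 < R) (hc : c < 1)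
    (hh : Continuous h) (hlip : LipschitzOnWith c h (ball 0 R))
    (hzero : ∀ x, ‖x‖ = R → h x = 0) (hmaps : ∀ x ∈ ball (0 : E) R, x + h x ∈ ball (0 : E) R) :
    Set.InjOn (fun x => x + h x) (ball 0 R) ∧ (fun x => x + h x) '' ball 0 R = ball 0 R := by
  have happ : ApproximatesLinearOn (fun x => x + h x)
      ((ContinuousLinearEquiv.refl ℝ E : E ≃L[ℝ] E) : E →L[ℝ] E) (ball 0 R) c := by
    apply LipschitzOnWith.approximatesLinearOn
    convert hlip using 1
    ext x
    simp
  have hN : Subsingleton E ∨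
      c < ‖((ContinuousLinearEquiv.refl ℝ E).symm : E →L[ℝ] E)‖₊⁻¹ := by
    rcases subsingleton_or_nontrivial E with hs | hs
    · exact Or.inl hs
    · right
      have : ‖((ContinuousLinearEquiv.refl ℝ E).symm : E →L[ℝ] E)‖₊ = 1 :=
        NNReal.eq ContinuousLinearMap.norm_id
      rwa [this, inv_one]
  refine ⟨happ.injOn hN, Set.Subset.antisymm (Set.image_subset_iff.2 hmaps) ?_⟩
  have hopen : IsOpen ((fun x => x + h x) '' ball 0 R) :=
    happ.open_image (ContinuousLinearEquiv.toNonlinearRightInverse _) isOpen_ball hN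
  have h0 : (0 : E) ∈ ball (0 : E) R := mem_ball_self hR
  refine (convex_ball (0 : E) R).isPreconnected.subset_of_closure_inter_subset hopen
    ⟨_, hmaps 0 h0, Set.mem_image_of_mem _ h0⟩ ?_
  rintro y ⟨hy, hyR⟩
  have hcpt : IsCompact ((fun x => x + h x) '' closedBall 0 R) :=
    (isCompact_closedBall 0 R).image (by fun_prop)
  obtain ⟨x, hx, rfl⟩ :=
    closure_minimal (Set.image_mono ball_subset_closedBall) hcpt.isClosed hy
  rcases (mem_closedBall_zero_iff.1 hx).lt_or_eq with hlt | heq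
  · exact ⟨x, mem_ball_zero_iff.2 hlt, rfl⟩
  · simp [hzero x heq, heq] at hyR

variable [MeasurableSpace E] [BorelSpace E]

theorem setIntegral_det_one_add_fderiv {h : E → E} {R : ℝ} {c : NNReal} (hR : 0 < R) (hc : c < 1)
    (hh : ContDiff ℝ 1 h) (hbound : ∀ x ∈ ball (0 : E) R, ‖fderiv ℝ h x‖ ≤ c)
    (hzero : ∀ x, ‖x‖ = R → h x = 0) (hmaps : ∀ x ∈ ball (0 : E) R, x + h x ∈ ball (0 : E) R) :
    ∫ x in ball (0 : E) R, (1 + fderiv ℝ h x).det = volume.real (ball (0 : E) R) := by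
  have hd : Differentiable ℝ h := hh.differentiable one_ne_zero
  have hlip : LipschitzOnWith c h (ball 0 R) :=
    (convex_ball 0 R).lipschitzOnWith_of_nnnorm_fderiv_le (𝕜 := ℝ) (fun x _ => hd x)
      fun x hx => hbound x hx
  obtain ⟨hinj, himg⟩ := image_ball_add_eq_ball hR hc hh.continuous hlip hzero hmaps
  have hcv := integral_image_eq_integral_abs_det_fderiv_smul volume
    (measurableSet_ball (x := (0 : E)) (ε := R))
    (f := fun x => x + h x) (f' := fun x => 1 + fderiv ℝ h x)
    (fun x _ => ((hasFDerivAt_id x).add (hd x).hasFDerivAt).hasFDerivWithinAt) hinj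
    (fun _ => (1 : ℝ))
  rw [himg] at hcv
  simp only [smul_eq_mul, mul_one, setIntegral_const] at hcv
  rw [hcv]
  refine setIntegral_congr_fun measurableSet_ball fun x hx => ?_
  exact (abs_of_pos (det_one_add_pos _ ((hbound x hx).trans_lt hc))).symm

theorem not_contDiff_retraction_sphere {r : E → E} {R : ℝ} (hR : 0 < R) (hr : ContDiff ℝ 1 r)
    (hn : ∀ x, ‖r x‖ = R) (hid : ∀ x, ‖x‖ = R → r x = x) : False := by
  have hd : Differentiable ℝ r := hr.differentiable one_ne_zero
  have hrf : Continuous (fderiv ℝ r) := hr.continuous_fderiv one_ne_zero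
  obtain ⟨M, hM⟩ := (isCompact_closedBall (0 : E) R).exists_bound_of_continuousOn
    (f := fun x => fderiv ℝ r x - 1) (by fun_prop)
  have hM0 : 0 ≤ M := (norm_nonneg _).trans (hM 0 (mem_closedBall_self hR.le))
  have hkey : ∀ t : ℝ, 0 < t → t < 1 → t * M < 1 →
      ∫ x in ball (0 : E) R, (1 + t • (fderiv ℝ r x - 1)).det = volume.real (ball (0 : E) R) := by
    intro t ht0 ht1 htM
    have hfd : ∀ x, fderiv ℝ (fun x => t • (r x - x)) x = t • (fderiv ℝ r x - 1) := fun x =>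
      (((hd x).hasFDerivAt.sub (hasFDerivAt_id x)).const_smul t).fderiv
    have := setIntegral_det_one_add_fderiv (h := fun x => t • (r x - x)) (R := R)
      (c := ⟨t * M, by positivity⟩) hR htM (by fun_prop) ?_ ?_ ?_
    · simpa only [hfd] using this
    · intro x hx
      rw [hfd, norm_smul, Real.norm_of_nonneg ht0.le]
      exact mul_le_mul_of_nonneg_left (hM x (ball_subset_closedBall hx)) ht0.le
    · intro x hx
      simp [hid x hx]
    · intro x hx
      rw [mem_ball_zero_iff] at hx ⊢
      calc ‖x + t • (r x - x)‖ = ‖(1 - t) • x + t • r x‖ := by congr 1; module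
        _ ≤ (1 - t) * ‖x‖ + t * R := by
          refine (norm_add_le _ _).trans_eq ?_
          rw [norm_smul, norm_smul, hn, Real.norm_of_nonneg ht0.le,
            Real.norm_of_nonneg (by linarith)]
        _ < R := by nlinarith
  let t : ℕ → ℝ := fun i => ((i : ℝ) + 2 + M)⁻¹
  have htinj : Function.Injective t := fun i j hij => by
    have := inv_injective hij
    simpa using this
  obtain ⟨w, hw, hdet⟩ := exists_weights_det_one_add (E := E)
    (Finset.range (Module.finrank ℝ E + 1)) t htinj.injOn (by simp)
  have hpos : ∀ i : ℕ, 0 < (i : ℝ) + 2 + M := fun i => by positivity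
  have hti : ∀ i, ∫ x in ball (0 : E) R, (1 + t i • (fderiv ℝ r x - 1)).det
      = volume.real (ball (0 : E) R) := fun i => by
    refine hkey (t i) (inv_pos.2 (hpos i)) (inv_lt_one_of_one_lt₀ ?_) ?_
    · linarith [(Nat.cast_nonneg i : (0 : ℝ) ≤ i)]
    · rw [inv_mul_lt_iff₀ (hpos i)]
      linarith [(Nat.cast_nonneg i : (0 : ℝ) ≤ i)]
  have hint : ∀ i, IntegrableOn (fun x => (1 + t i • (fderiv ℝ r x - 1)).det) (ball (0 : E) R) :=
    fun i => ((ContinuousLinearMap.continuous_det.comp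
      (by fun_prop)).continuousOn.integrableOn_compact (isCompact_closedBall (0 : E) R)).mono_set
        ball_subset_closedBall
  have hsum : ∫ x in ball (0 : E) R, (fderiv ℝ r x).det = volume.real (ball (0 : E) R) := by
    calc ∫ x in ball (0 : E) R, (fderiv ℝ r x).det
        = ∫ x in ball (0 : E) R, ∑ i ∈ Finset.range (Module.finrank ℝ E + 1),
            w i * (1 + t i • (fderiv ℝ r x - 1)).det := by
          congr 1
          funext x
          refine Eq.trans ?_ (hdet ((fderiv ℝ r x - 1 : E →L[ℝ] E) : E →ₗ[ℝ] E))
          refine congrArg ContinuousLinearMap.det (?_ : fderiv ℝ r x = 1 + (fderiv ℝ r x - 1))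
          abel
      _ = ∑ i ∈ Finset.range (Module.finrank ℝ E + 1), w i * volume.real (ball (0 : E) R) := by
          rw [integral_finsetSum _ fun i _ => (hint i).const_mul (w i)]
          simp only [integral_const_mul, hti]
      _ = volume.real (ball (0 : E) R) := by rw [← Finset.sum_mul, hw, one_mul]
  simp only [det_fderiv_eq_zero_of_norm_const hR hd hn, integral_zero] at hsum
  exact (ENNReal.toReal_pos (measure_ball_pos volume (0 : E) hR).ne' measure_ball_lt_top.ne).ne hsum

end Analytic

/-- Brouwer's fixed point theorem, for maps of the whole space into its closed unit ball. -/
theorem exists_fixedPoint_of_norm_le_one {E : Type*} [NormedAddCommGroup E]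
    [InnerProductSpace ℝ E] [FiniteDimensional ℝ E] {f : E → E} (hf : Continuous f)
    (hb : ∀ x, ‖f x‖ ≤ 1) : ∃ x, f x = x := by
  by_contra! hne
  let _ : MeasurableSpace E := borel E
  have _ : BorelSpace E := ⟨rfl⟩
  let l : E → ℝ := fun x => max 0 (min 1 (2 - ‖x‖))
  let F : E → E := fun x => x - l x • f x
  have hl0 : ∀ x, 0 ≤ l x := fun x => le_max_left _ _
  have hl1 : ∀ x, l x ≤ 1 := fun x => max_le zero_le_one (min_le_left _ _)
  have hFid : ∀ x, 2 ≤ ‖x‖ → F x = x := by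
    intro x hx
    have : l x = 0 := max_eq_left ((min_le_right _ _).trans (by linarith))
    simp [F, this]
  have hF0 : ∀ x, F x ≠ 0 := by
    intro x hx
    have h1 : x = l x • f x := sub_eq_zero.1 hx
    have h2 : ‖x‖ ≤ 1 := by
      rw [h1, norm_smul, Real.norm_of_nonneg (hl0 x)]
      exact mul_le_one₀ (hl1 x) (norm_nonneg _) (hb x)
    have h3 : l x = 1 := by
      simp only [l]
      rw [min_eq_left (by linarith), max_eq_right zero_le_one]
    rw [h3, one_smul] at h1
    exact hne x h1.symm
  have hFc : Continuous F := by fun_prop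
  have hU : {x : E | 2 < ‖x‖} ∈ nhdsSet {x : E | 3 ≤ ‖x‖} :=
    (isOpen_lt continuous_const continuous_norm).mem_nhdsSet.2 fun x (hx : 3 ≤ ‖x‖) =>
      show 2 < ‖x‖ by linarith
  obtain ⟨g, hg, hgF, hgid, -⟩ := hFc.exists_contDiff_approx_and_eqOn 1
    (ε := fun x => ‖F x‖) (by fun_prop) (fun x => norm_pos_iff.2 (hF0 x))
    (isClosed_le continuous_const continuous_norm) hU
    (contDiffOn_id.congr fun x (hx : 2 < ‖x‖) => hFid x hx.le)
  have hg0 : ∀ x, g x ≠ 0 := by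
    intro x hx
    have := hgF x
    rw [hx, dist_zero_left] at this
    exact this.false
  have hg1 : ContDiff ℝ 1 g := hg
  refine not_contDiff_retraction_sphere (r := fun x => (3 * ‖g x‖⁻¹) • g x) (R := 3)
    (by norm_num) ?_ ?_ ?_
  · exact (contDiff_const.mul ((hg1.norm ℝ hg0).inv fun x => norm_ne_zero_iff.2 (hg0 x))).smul hg1
  · intro x
    have := norm_ne_zero_iff.2 (hg0 x)
    rw [norm_smul, Real.norm_of_nonneg (by positivity)]
    field_simp
  · intro x hx
    have h1 : g x = x := (hgid (show 3 ≤ ‖x‖ from hx.ge)).trans (hFid x (by linarith))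
    simp [h1, hx]

theorem convex_halfSpace (n : ℕ) : Convex ℝ (HalfSpace n) := by
  intro x hx y hy a b ha hb _
  simp only [HalfSpace, Set.mem_ofPred_eq] at *
  simp only [PiLp.add_apply, PiLp.smul_apply, smul_eq_mul]
  positivity

theorem smul_mem_halfSpace {n : ℕ} {x : Euc (n + 1)} (hx : x ∈ HalfSpace n) {t : ℝ}
    (ht : 0 ≤ t) : t • x ∈ HalfSpace n :=
  show 0 ≤ (t • x) (Fin.last n) from mul_nonneg ht hx

/-- A bornologous self-map of the half-space is at bounded distance from a continuous one. -/
theorem exists_continuous_close {n : ℕ} {f : HalfSpace n → HalfSpace n} {S : ℝ}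
    (hS : ∀ x y, dist x y ≤ 1 → dist (f x) (f y) ≤ S) :
    ∃ g : C(HalfSpace n, Euc (n + 1)), ∀ x, g x ∈ HalfSpace n ∧ dist (g x) (f x) ≤ S :=
  exists_continuous_forall_mem_convex_of_local_const
    (t := fun x => HalfSpace n ∩ closedBall (f x : Euc (n + 1)) S)
    (fun x => (convex_halfSpace n).inter (convex_closedBall _ _))
    fun x => ⟨f x, by
      filter_upwards [closedBall_mem_nhds x one_pos] with y hy
      exact ⟨(f x).2, hS x y (by rwa [dist_comm])⟩⟩

/-- Vertical projection of the unit ball onto the upper hemisphere. -/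
def hemisphereProj (n : ℕ) (x : Euc (n + 1)) : Euc (n + 1) :=
  x + (√(1 - ‖x‖ ^ 2 + x (Fin.last n) ^ 2) - x (Fin.last n)) • EuclideanSpace.single (Fin.last n) 1

theorem continuous_hemisphereProj (n : ℕ) : Continuous (hemisphereProj n) := by
  unfold hemisphereProj
  fun_prop

theorem hemisphereProj_last (n : ℕ) (x : Euc (n + 1)) :
    hemisphereProj n x (Fin.last n) = √(1 - ‖x‖ ^ 2 + x (Fin.last n) ^ 2) := by
  simp [hemisphereProj]

theorem hemisphereProj_mem (n : ℕ) (x : Euc (n + 1)) : hemisphereProj n x ∈ HalfSpace n :=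
  (Real.sqrt_nonneg _).trans_eq (hemisphereProj_last n x).symm

theorem norm_hemisphereProj {n : ℕ} {x : Euc (n + 1)} (hx : ‖x‖ ≤ 1) :
    ‖hemisphereProj n x‖ = 1 := by
  have h : ‖hemisphereProj n x‖ ^ 2 = 1 := by
    have hs : 0 ≤ 1 - ‖x‖ ^ 2 + x (Fin.last n) ^ 2 := by
      nlinarith [norm_nonneg x, sq_nonneg (x (Fin.last n))]
    rw [hemisphereProj, norm_add_sq_real, real_inner_smul_right, norm_smul, mul_pow,
      EuclideanSpace.inner_single_right]
    simp
    nlinarith [Real.sq_sqrt hs]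
  exact (pow_eq_one_iff_of_nonneg (norm_nonneg _) two_ne_zero).1 h

theorem hemisphereProj_of_norm_eq_one {n : ℕ} {x : Euc (n + 1)} (hx : ‖x‖ = 1)
    (hx' : x ∈ HalfSpace n) : hemisphereProj n x = x := by
  have : 0 ≤ x (Fin.last n) := hx'
  simp [hemisphereProj, hx, Real.sqrt_sq this]

/-- A continuous self-map of the half-space preserves some ray direction on each hemisphere
on which its norm is at least one. -/
theorem exists_eq_norm_smul {n : ℕ} (g : C(HalfSpace n, Euc (n + 1)))
    (hg : ∀ x, g x ∈ HalfSpace n) {k : ℝ} (hk : 0 ≤ k)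
    (hg1 : ∀ x : HalfSpace n, ‖(x : Euc (n + 1))‖ = k → 1 ≤ ‖g x‖) :
    ∃ x : HalfSpace n, ∃ z : Euc (n + 1), ‖z‖ = 1 ∧ (x : Euc (n + 1)) = k • z ∧
      g x = ‖g x‖ • z := by
  let p : Euc (n + 1) → HalfSpace n := fun x =>
    ⟨k • hemisphereProj n x, smul_mem_halfSpace (hemisphereProj_mem n x) hk⟩
  have hp : Continuous p := ((continuous_hemisphereProj n).const_smul k).subtype_mk _
  have hpos : ∀ x, 0 < max 1 ‖g (p x)‖ := fun x => zero_lt_one.trans_le (le_max_left _ _)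
  have hgp : Continuous fun x => g (p x) := g.continuous.comp hp
  obtain ⟨z, hz⟩ := exists_fixedPoint_of_norm_le_one
    (f := fun x => (max 1 ‖g (p x)‖)⁻¹ • g (p x))
    (((continuous_const.max hgp.norm).inv₀ fun x => (hpos x).ne').smul hgp)
    (fun x => by
      rw [norm_smul, norm_inv, Real.norm_of_nonneg (hpos x).le, inv_mul_le_iff₀ (hpos x), mul_one]
      exact le_max_right _ _)
  have hz1 : ‖z‖ ≤ 1 := by
    rw [← hz, norm_smul, norm_inv, Real.norm_of_nonneg (hpos z).le, inv_mul_le_iff₀ (hpos z),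
      mul_one]
    exact le_max_right _ _
  have hpz : ‖(p z : Euc (n + 1))‖ = k := by
    simp [p, norm_smul, norm_hemisphereProj hz1, abs_of_nonneg hk]
  have h1 := hg1 _ hpz
  rw [max_eq_right h1] at hz
  have h0 : ‖g (p z)‖ ≠ 0 := by linarith
  have hzn : ‖z‖ = 1 := by
    rw [← hz, norm_smul, norm_inv, norm_norm, inv_mul_cancel₀ h0]
  have hzH : z ∈ HalfSpace n := by
    rw [← hz]
    exact smul_mem_halfSpace (hg _) (by positivity)
  refine ⟨p z, z, hzn, ?_, ?_⟩
  · simp [p, hemisphereProj_of_norm_eq_one hzn hzH]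
  · exact (inv_smul_eq_iff₀ h0).1 hz

theorem mem_openCone_of_smul_mem {m : ℕ} {V : Set (Euc m)} {w : Euc m} (hw : w ≠ 0)
    (h : ‖w‖⁻¹ • w ∈ V) : w ∈ OpenCone (V ∩ sphere (0 : Euc m) 1) := by
  have h0 := norm_ne_zero_iff.2 hw
  refine ⟨‖w‖, norm_nonneg _, ‖w‖⁻¹ • w, ⟨h, ?_⟩, (smul_inv_smul₀ h0 w).symm⟩
  rw [mem_sphere_zero_iff_norm, norm_smul, norm_inv, norm_norm, inv_mul_cancel₀ h0]

/-- If `v` points in the unit direction `z`, the direction of `w` is close to `z`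
once `w` is much longer than its distance to `v`. -/
theorem dist_inv_norm_smul_le {E : Type*} [NormedAddCommGroup E] [NormedSpace ℝ E] {v w z : E}
    (hz : ‖z‖ = 1) (hv : v = ‖v‖ • z) (hw : w ≠ 0) :
    dist (‖w‖⁻¹ • w) z ≤ 2 * dist v w / ‖w‖ := by
  have h0 : 0 < ‖w‖ := norm_pos_iff.2 hw
  have h1 : ‖w‖⁻¹ • w - z = ‖w‖⁻¹ • ((w - v) + (‖v‖ - ‖w‖) • z) := by
    rw [sub_smul, ← hv, sub_add_sub_cancel, smul_sub, inv_smul_smul₀ h0.ne']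
  rw [dist_eq_norm, h1, norm_smul, norm_inv, norm_norm, inv_mul_eq_div]
  gcongr
  refine (norm_add_le _ _).trans ?_
  rw [norm_smul, hz, mul_one, two_mul, dist_eq_norm, norm_sub_rev w v]
  gcongr
  exact abs_norm_sub_norm_le v w

end WCFP

/-- Every coarse map from the half-space `H^{n+1} = ℝ^n × [0,∞)` to itself has the
weak coarse fixed point property. -/
theorem weak_coarse_fixed_point_halfSpace (n : ℕ) (hn : 1 ≤ n)
    (f : HalfSpace n → HalfSpace n) (hf : IsCoarseMap f) :
    ∃ ζ : Euc (n+1), ‖ζ‖ = 1 ∧ ζ ∈ HalfSpace n ∧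
      ∀ U : Set (Euc (n+1)),
        U ⊆ sphere (0 : Euc (n+1)) 1 → ζ ∈ U →
        (∃ V : Set (Euc (n+1)), IsOpen V ∧ U = V ∩ sphere (0 : Euc (n+1)) 1) →
        ∃ x : ℕ → HalfSpace n,
          Tendsto (fun i => ‖(x i : Euc (n+1))‖) atTop atTop ∧
          ∀ i, (x i : Euc (n+1)) ∈ OpenCone U ∧ (f (x i) : Euc (n+1)) ∈ OpenCone U := by
  obtain ⟨hproper, hborn⟩ := hf
  obtain ⟨S, hS0, hS⟩ := hborn 1 one_pos
  obtain ⟨g, hg⟩ := WCFP.exists_continuous_close hS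
  have hgrow : ∀ r : ℝ, ∃ K : ℝ, ∀ x : HalfSpace n, K < ‖(x : Euc (n+1))‖ →
      r < ‖(f x : Euc (n+1))‖ := by
    intro r
    let o : HalfSpace n := ⟨0, show (0 : ℝ) ≤ 0 from le_rfl⟩
    obtain ⟨K, hK⟩ := (isBounded_iff_subset_closedBall o).1
      (hproper _ (isBounded_closedBall (x := o) (r := r)))
    refine ⟨K, fun x hx => ?_⟩
    by_contra! hle
    have h1 : x ∈ closedBall o K :=
      hK (show dist (f x : Euc (n+1)) 0 ≤ r by rwa [dist_zero_right])
    have h2 : dist (x : Euc (n+1)) 0 ≤ K := h1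
    rw [dist_zero_right] at h2
    linarith
  obtain ⟨K, hK⟩ := hgrow (1 + S)
  have hray : ∀ i : ℕ, ∃ x : HalfSpace n, ∃ z : Euc (n+1), ‖z‖ = 1 ∧
      (x : Euc (n+1)) = ((i : ℝ) + 1 + |K|) • z ∧ g x = ‖g x‖ • z := by
    intro i
    refine WCFP.exists_eq_norm_smul g (fun x => (hg x).1) (by positivity) fun x hx => ?_
    have h1 := hK x (by rw [hx]; linarith [le_abs_self K, (Nat.cast_nonneg i : (0 : ℝ) ≤ i)])
    have h2 := norm_sub_norm_le (f x : Euc (n+1)) (g x)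
    rw [← dist_eq_norm, dist_comm] at h2
    linarith [(hg x).2]
  choose x z hz hxz hgz using hray
  have hxn : ∀ i, ‖(x i : Euc (n+1))‖ = (i : ℝ) + 1 + |K| := fun i => by
    rw [hxz, norm_smul, hz, mul_one, Real.norm_of_nonneg (by positivity)]
  have hxpos : ∀ i, 0 < ‖(x i : Euc (n+1))‖ := fun i => by rw [hxn]; positivity
  have hxtop : Tendsto (fun i => ‖(x i : Euc (n+1))‖) atTop atTop := by
    simp only [hxn, add_assoc]
    exact tendsto_atTop_add_const_right _ _ tendsto_natCast_atTop_atTop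
  have hftop : Tendsto (fun i => ‖(f (x i) : Euc (n+1))‖) atTop atTop := by
    refine tendsto_atTop.2 fun r => ?_
    obtain ⟨L, hL⟩ := hgrow r
    filter_upwards [hxtop.eventually_gt_atTop L] with i hi using (hL _ hi).le
  obtain ⟨ζ, hζ, φ, hφ, hlim⟩ := (isCompact_sphere (0 : Euc (n+1)) 1).tendsto_subseq
    (fun i => mem_sphere_zero_iff_norm.2 (hz i))
  have hζH : ζ ∈ HalfSpace n := by
    have hcl : IsClosed (HalfSpace n) := isClosed_le continuous_const (by fun_prop)
    refine hcl.mem_of_tendsto hlim (Eventually.of_forall fun j => ?_)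
    have h1 : z (φ j) = ‖(x (φ j) : Euc (n+1))‖⁻¹ • (x (φ j) : Euc (n+1)) := by
      conv_rhs => rw [hxn, hxz]
      rw [inv_smul_smul₀ (by positivity)]
    simp only [Function.comp_apply]
    rw [h1]
    exact WCFP.smul_mem_halfSpace (x (φ j)).2 (by positivity)
  refine ⟨ζ, mem_sphere_zero_iff_norm.1 hζ, hζH, ?_⟩
  rintro U - hζU ⟨V, hV, rfl⟩
  have hdir : Tendsto (fun j => ‖(f (x (φ j)) : Euc (n+1))‖⁻¹ • (f (x (φ j)) : Euc (n+1)))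
      atTop (nhds ζ) := by
    have hsmall : Tendsto (fun j => 2 * S / ‖(f (x (φ j)) : Euc (n+1))‖) atTop (nhds 0) :=
      (hftop.comp hφ.tendsto_atTop).const_div_atTop _
    refine (tendsto_iff_of_dist (squeeze_zero' (Eventually.of_forall fun _ => dist_nonneg)
      ?_ hsmall)).1 hlim
    filter_upwards [(hftop.comp hφ.tendsto_atTop).eventually_gt_atTop 0] with j hj
    rw [dist_comm]
    refine (WCFP.dist_inv_norm_smul_le (hz _) (hgz _) (norm_pos_iff.1 hj)).trans ?_
    gcongr
    exact (hg _).2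
  have hev : ∀ᶠ j in atTop, z (φ j) ∈ V ∧
      ‖(f (x (φ j)) : Euc (n+1))‖⁻¹ • (f (x (φ j)) : Euc (n+1)) ∈ V ∧
      0 < ‖(f (x (φ j)) : Euc (n+1))‖ :=
    (hlim.eventually (hV.mem_nhds hζU.1)).and ((hdir.eventually (hV.mem_nhds hζU.1)).and
      ((hftop.comp hφ.tendsto_atTop).eventually_gt_atTop 0))
  obtain ⟨N, hN⟩ := eventually_atTop.1 hev
  refine ⟨fun i => x (φ (i + N)), ?_, fun i => ?_⟩
  · exact hxtop.comp (hφ.tendsto_atTop.comp (tendsto_add_atTop_nat N))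
  · obtain ⟨h1, h2, h3⟩ := hN (i + N) (Nat.le_add_left _ _)
    refine ⟨⟨_, ?_, z (φ (i + N)), ⟨h1, mem_sphere_zero_iff_norm.2 (hz _)⟩, hxz _⟩,
      WCFP.mem_openCone_of_smul_mem (norm_pos_iff.1 h3) h2⟩
    positivity
end
end
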